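/- arXiv:2409.18318 — 11 statements merged into one kernel-verified Lean document; each statement's English description precedes it below -/
import Mathlib

section
/- For positive integers α, β, γ, δ with A = α·δ + β·γ, the least positive integer ξ such that (ξ, 0) ∈ Λ(α,β,γ,δ) equals A / gcd(β, δ). (In the cycloid C(α,β,γ,δ) the length of every forward-cycle is p = A/gcd(β,δ).) -/
/-- The cycloid lattice Λ(α,β,γ,δ): the additive subgroup of ℤ × ℤ generated by
the vectors (α, -β) and (γ, δ). -/
def cycloidLattice (α β γ δ : ℕ) : AddSubgroup (ℤ × ℤ) :=
  AddSubgroup.closure {((α : ℤ), -(β : ℤ)), ((γ : ℤ), (δ : ℤ))}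

theorem forward_cycle_length (α β γ δ : ℕ)
    (hα : 0 < α) (hβ : 0 < β) (hγ : 0 < γ) (hδ : 0 < δ) :
    IsLeast {ξ : ℕ | 0 < ξ ∧ ((ξ : ℤ), (0 : ℤ)) ∈ cycloidLattice α β γ δ}
      ((α * δ + β * γ) / Nat.gcd β δ) := by
  have hg : 0 < Nat.gcd β δ := Nat.gcd_pos_of_pos_left δ hβ
  obtain ⟨b, d, hco, hb, hd⟩ := Nat.exists_coprime β δ
  generalize Nat.gcd β δ = g at *
  subst hb hd
  have hb0 : 0 < b := Nat.pos_of_mul_pos_right hβ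
  have hd0 : 0 < d := Nat.pos_of_mul_pos_right hδ
  have hA : (α * (d * g) + b * g * γ) / g = α * d + b * γ := by
    rw [show α * (d * g) + b * g * γ = (α * d + b * γ) * g by ring]
    exact Nat.mul_div_cancel _ hg
  rw [hA]
  constructor
  · refine ⟨by positivity, ?_⟩
    rw [cycloidLattice, AddSubgroup.mem_closure_pair]
    refine ⟨d, b, ?_⟩
    ext
    · simp; ring
    · simp; ring
  · rintro ξ ⟨hξ, hmem⟩
    rw [cycloidLattice, AddSubgroup.mem_closure_pair] at hmem
    obtain ⟨m, n, h⟩ := hmem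
    have h1 : m * α + n * γ = (ξ : ℤ) := by simpa using congrArg Prod.fst h
    have h2 : -(m * (b * g)) + n * (d * g) = (0 : ℤ) := by simpa using congrArg Prod.snd h
    have hgz : (g : ℤ) ≠ 0 := by exact_mod_cast hg.ne'
    have hdz : (d : ℤ) ≠ 0 := by exact_mod_cast hd0.ne'
    have h3 : m * b = n * (d : ℤ) := by
      apply mul_right_cancel₀ hgz
      linarith
    have hdvd : (d : ℤ) ∣ m := by
      have hc : IsCoprime (d : ℤ) (b : ℤ) := (Nat.isCoprime_iff_coprime.mpr hco).symm
      exact hc.dvd_of_dvd_mul_right ⟨n, by rw [h3]; ring⟩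
    obtain ⟨k, rfl⟩ := hdvd
    have hn : n = b * k := by
      apply mul_right_cancel₀ hdz
      linarith
    subst hn
    have h4 : ((α * d + b * γ : ℕ) : ℤ) ∣ (ξ : ℤ) := ⟨k, by rw [← h1]; push_cast; ring⟩
    exact Nat.le_of_dvd hξ (Int.natCast_dvd_natCast.mp h4)
end

section
/- For positive integers α, β, γ, δ with A = α·δ + β·γ, the least positive integer η such that (0, η) ∈ Λ(α,β,γ,δ) equals A / gcd(α, γ). (In the cycloid C(α,β,γ,δ) the length of every backward-cycle is p′ = A/gcd(α,γ).) -/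
theorem backward_cycle_length (α β γ δ : ℕ)
    (hα : 0 < α) (hβ : 0 < β) (hγ : 0 < γ) (hδ : 0 < δ) :
    IsLeast {η : ℕ | 0 < η ∧ ((0 : ℤ), (η : ℤ)) ∈ cycloidLattice α β γ δ}
      ((α * δ + β * γ) / Nat.gcd α γ) := by
  obtain ⟨g, a, c, hg, hac, rfl, rfl⟩ := Nat.exists_coprime' (m := α) (n := γ)
    (Nat.gcd_pos_of_pos_left _ hα)
  have hgcd : Nat.gcd (a * g) (c * g) = g := by
    rw [Nat.gcd_mul_right, hac.gcd_eq_one, one_mul]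
  have hA : (a * g * δ + β * (c * g)) / g = a * δ + β * c := by
    rw [show a * g * δ + β * (c * g) = (a * δ + β * c) * g by ring]
    exact Nat.mul_div_cancel _ hg
  rw [hgcd, hA]
  have ha : 0 < a := Nat.pos_of_mul_pos_right hα
  have hpos : 0 < a * δ + β * c := by positivity
  have hmem : ∀ η : ℕ, ((0 : ℤ), (η : ℤ)) ∈ cycloidLattice (a * g) β (c * g) δ ↔
      ∃ m n : ℤ, m * (a * g) + n * (c * g) = 0 ∧ -(m * β) + n * δ = η := by
    intro η
    unfold cycloidLattice
    rw [AddSubgroup.mem_closure_pair]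
    simp [Prod.ext_iff]
  constructor
  · refine ⟨hpos, (hmem _).2 ⟨-c, a, by ring, by push_cast; ring⟩⟩
  · rintro η ⟨hη, h⟩
    obtain ⟨m, n, h1, h2⟩ := (hmem _).1 h
    have hg' : (g : ℤ) ≠ 0 := by exact_mod_cast hg.ne'
    have h3 : m * a + n * c = 0 := by
      apply mul_right_cancel₀ hg'
      linear_combination h1
    have hd : (a : ℤ) ∣ n := by
      have hco : IsCoprime (a : ℤ) (c : ℤ) := Nat.isCoprime_iff_coprime.2 hac
      exact hco.dvd_of_dvd_mul_right ⟨-m, by linear_combination h3⟩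
    obtain ⟨k, rfl⟩ := hd
    have ha' : (a : ℤ) ≠ 0 := by exact_mod_cast ha.ne'
    have h4 : m = -(k * c) := by
      apply mul_right_cancel₀ ha'
      linear_combination h3
    subst h4
    apply Nat.le_of_dvd hη
    have : ((a * δ + β * c : ℕ) : ℤ) ∣ (η : ℤ) :=
      ⟨k, by push_cast; linear_combination -h2⟩
    exact_mod_cast this
end

section
/- Let α, β, γ, δ be positive integers with A = α·δ + β·γ, and let u = (u₁, u₂) ∈ ℤ × ℤ. Define m = ⌊(u₁·δ − u₂·γ)/A⌋ and n = ⌊(u₂·α + u₁·β)/A⌋ (floor division over ℤ). Then the point x = (u₁ − m·α − n·γ, u₂ + m·β − n·δ) lies in the fundamental parallelogram and x is equivalent to u, i.e. x − u ∈ Λ(α,β,γ,δ). -/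
/-- A point (x₁, x₂) lies in the fundamental parallelogram of the cycloid
C(α,β,γ,δ) iff 0 ≤ δ·x₁ − γ·x₂ < A and 0 ≤ β·x₁ + α·x₂ < A, where A = αδ + βγ. -/
def inFundamentalParallelogram (α β γ δ : ℕ) (x : ℤ × ℤ) : Prop :=
  0 ≤ (δ : ℤ) * x.1 - γ * x.2 ∧ (δ : ℤ) * x.1 - γ * x.2 < (α : ℤ) * δ + β * γ ∧
  0 ≤ (β : ℤ) * x.1 + α * x.2 ∧ (β : ℤ) * x.1 + α * x.2 < (α : ℤ) * δ + β * γ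

theorem to_fundamental_parallelogram (α β γ δ : ℕ)
    (hα : 0 < α) (hβ : 0 < β) (hγ : 0 < γ) (hδ : 0 < δ)
    (A : ℤ) (hA : A = (α : ℤ) * δ + β * γ) (u₁ u₂ : ℤ)
    (m n : ℤ) (hm : m = Int.fdiv (u₁ * δ - u₂ * γ) A)
    (hn : n = Int.fdiv (u₂ * α + u₁ * β) A) :
    inFundamentalParallelogram α β γ δ (u₁ - m * α - n * γ, u₂ + m * β - n * δ) ∧
      (u₁ - m * α - n * γ, u₂ + m * β - n * δ) - (u₁, u₂) ∈
        cycloidLattice α β γ δ := by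
  have hpos : 0 < A := by
    rw [hA]
    positivity
  rw [Int.fdiv_eq_ediv_of_nonneg _ hpos.le] at hm hn
  have h1 := Int.emod_add_mul_ediv (u₁ * δ - u₂ * γ) A
  have h2 := Int.emod_nonneg (u₁ * δ - u₂ * γ) hpos.ne'
  have h3 := Int.emod_lt_of_pos (u₁ * δ - u₂ * γ) hpos
  have k1 := Int.emod_add_mul_ediv (u₂ * α + u₁ * β) A
  have k2 := Int.emod_nonneg (u₂ * α + u₁ * β) hpos.ne'
  have k3 := Int.emod_lt_of_pos (u₂ * α + u₁ * β) hpos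
  rw [← hm] at h1
  rw [← hn] at k1
  have e1 : (δ : ℤ) * (u₁ - m * α - n * γ) - γ * (u₂ + m * β - n * δ)
      = (u₁ * δ - u₂ * γ) % A := by
    rw [eq_sub_of_add_eq h1, hA]
    ring
  have e2 : (β : ℤ) * (u₁ - m * α - n * γ) + α * (u₂ + m * β - n * δ)
      = (u₂ * α + u₁ * β) % A := by
    rw [eq_sub_of_add_eq k1, hA]
    ring
  refine ⟨?_, ?_⟩
  · unfold inFundamentalParallelogram
    simp only
    rw [e1, e2, ← hA]
    exact ⟨h2, h3, k2, k3⟩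
  · unfold cycloidLattice
    rw [AddSubgroup.mem_closure_pair]
    refine ⟨-m, -n, ?_⟩
    ext
    · simp
      ring
    · simp
      ring
end

section
/- Let α, β, γ, δ be positive integers with A = α·δ + β·γ. If two points x, y ∈ ℤ × ℤ both lie in the fundamental parallelogram and x − y ∈ Λ(α,β,γ,δ), then x = y. (Each equivalence class of the Petri space contains a unique element of the fundamental parallelogram.) -/
theorem fundamental_parallelogram_unique (α β γ δ : ℕ)
    (hα : 0 < α) (hβ : 0 < β) (hγ : 0 < γ) (hδ : 0 < δ)
    (x y : ℤ × ℤ)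
    (hx : inFundamentalParallelogram α β γ δ x)
    (hy : inFundamentalParallelogram α β γ δ y)
    (hxy : x - y ∈ cycloidLattice α β γ δ) : x = y := by
  obtain ⟨m, n, hmn⟩ := AddSubgroup.mem_closure_pair.mp hxy
  obtain ⟨x1, x2⟩ := x
  obtain ⟨y1, y2⟩ := y
  simp only [inFundamentalParallelogram] at hx hy
  obtain ⟨a1, a2, a3, a4⟩ := hx
  obtain ⟨b1, b2, b3, b4⟩ := hy
  simp only [Prod.smul_mk, Prod.mk_add_mk, Prod.mk_sub_mk, Prod.mk.injEq, smul_eq_mul] at hmn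
  obtain ⟨h1, h2⟩ := hmn
  have hA : (0 : ℤ) < (α : ℤ) * δ + β * γ := by positivity
  have key : ∀ k u v : ℤ, 0 ≤ u → u < (α : ℤ) * δ + β * γ → 0 ≤ v →
      v < (α : ℤ) * δ + β * γ → k * ((α : ℤ) * δ + β * γ) = u - v → k = 0 := by
    intro k u v hu hu' hv hv' hk
    have h3 : k < 1 := by
      by_contra h
      nlinarith
    have h4 : -1 < k := by
      by_contra h
      nlinarith
    omega
  have hm : m = 0 := by
    refine key m _ _ a1 a2 b1 b2 ?_
    linear_combination (δ : ℤ) * h1 - γ * h2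
  have hn : n = 0 := by
    refine key n _ _ a3 a4 b3 b4 ?_
    linear_combination (β : ℤ) * h1 + α * h2
  subst hm hn
  ext <;> simp only <;> linarith
end

section
/- For positive integers α, β, γ, δ, the additive subgroup of ℤ × ℤ generated by the three vectors (1, 0), (α, −β) and (γ, δ) has index gcd(β, δ) in ℤ × ℤ. (The cycloid C(α,β,γ,δ) contains exactly gcd(β,δ) pairwise disjoint forward-cycles.) -/
theorem number_of_forward_cycles (α β γ δ : ℕ)
    (hα : 0 < α) (hβ : 0 < β) (hγ : 0 < γ) (hδ : 0 < δ) :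
    (AddSubgroup.closure {((1 : ℤ), (0 : ℤ)), ((α : ℤ), -(β : ℤ)),
      ((γ : ℤ), (δ : ℤ))} : AddSubgroup (ℤ × ℤ)).index = Nat.gcd β δ := by
  have key : (AddSubgroup.closure {((1 : ℤ), (0 : ℤ)), ((α : ℤ), -(β : ℤ)),
      ((γ : ℤ), (δ : ℤ))} : AddSubgroup (ℤ × ℤ)) =
      (AddSubgroup.zmultiples ((Nat.gcd β δ : ℕ) : ℤ)).comap (AddMonoidHom.snd ℤ ℤ) := by
    apply le_antisymm
    · rw [AddSubgroup.closure_le]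
      have h1 : ((Nat.gcd β δ : ℕ) : ℤ) ∣ β := Int.natCast_dvd_natCast.2 (Nat.gcd_dvd_left _ _)
      have h2 : ((Nat.gcd β δ : ℕ) : ℤ) ∣ δ := Int.natCast_dvd_natCast.2 (Nat.gcd_dvd_right _ _)
      rintro x (rfl | rfl | rfl) <;>
        simp only [SetLike.mem_coe, AddSubgroup.mem_comap, AddMonoidHom.coe_snd,
          Int.mem_zmultiples_iff]
      · exact dvd_zero _
      · exact (dvd_neg).2 h1
      · exact h2
    · rintro ⟨x, y⟩ h
      simp only [AddSubgroup.mem_comap, AddMonoidHom.coe_snd, Int.mem_zmultiples_iff] at h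
      obtain ⟨k, rfl⟩ := h
      rw [Nat.gcd_eq_gcd_ab]
      set a := Nat.gcdA β δ
      set b := Nat.gcdB β δ
      have e : ((x, ((β : ℤ) * a + δ * b) * k) : ℤ × ℤ) =
          (x + k * a * α - k * b * γ) • ((1 : ℤ), (0 : ℤ)) +
          (-(k * a)) • ((α : ℤ), -(β : ℤ)) + (k * b) • ((γ : ℤ), (δ : ℤ)) := by
        ext <;> simp <;> ring
      rw [e]
      refine add_mem (add_mem ?_ ?_) ?_ <;>
        exact AddSubgroup.zsmul_mem _ (AddSubgroup.subset_closure (by simp)) _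
  rw [key, AddSubgroup.index_comap_of_surjective _ (fun y => ⟨(0, y), rfl⟩),
    Int.index_zmultiples, Int.natAbs_natCast]
end

section
/- For positive integers α, β, γ, δ with A = α·δ + β·γ, the following are equivalent: (i) β divides δ; (ii) the least positive integer ξ such that (ξ, 0) ∈ Λ(α,β,γ,δ) equals A/β. (A cycloid system is regular — each forward cycle contains exactly one token — if and only if β ∣ δ, and in this case it contains β processes, each of length p = A/β.) -/
theorem mem_cycloid_iff (α β γ δ : ℕ) (ξ : ℕ) :
    ((ξ : ℤ), (0 : ℤ)) ∈ cycloidLattice α β γ δ ↔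
      ∃ m n : ℤ, m * α + n * γ = ξ ∧ m * β = n * δ := by
  unfold cycloidLattice
  rw [AddSubgroup.mem_closure_pair]
  refine exists_congr fun m => exists_congr fun n => ?_
  simp only [Prod.smul_mk, Prod.mk_add_mk, Prod.mk.injEq, smul_eq_mul]
  refine and_congr_right fun _ => ?_
  constructor <;> intro h <;> linarith

theorem regular_iff_forward_cycle_length (α β γ δ : ℕ)
    (hα : 0 < α) (hβ : 0 < β) (hγ : 0 < γ) (hδ : 0 < δ) :
    β ∣ δ ↔
      IsLeast {ξ : ℕ | 0 < ξ ∧ ((ξ : ℤ), (0 : ℤ)) ∈ cycloidLattice α β γ δ}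
        ((α * δ + β * γ) / β) := by
  have key : ∀ (ξ : ℕ) (m n : ℤ), m * α + n * γ = ξ → m * β = n * δ →
      (ξ : ℤ) * β = n * (α * δ + β * γ) := by
    intro ξ m n h1 h2
    rw [← h1]
    linear_combination (α : ℤ) * h2
  have hβ' : (0 : ℤ) < β := by exact_mod_cast hβ
  have hA : (0 : ℤ) < α * δ + β * γ := by positivity
  constructor
  · rintro ⟨k, rfl⟩
    have hq : (α * (β * k) + β * γ) / β = α * k + γ := by
      rw [show α * (β * k) + β * γ = β * (α * k + γ) by ring]
      exact Nat.mul_div_cancel_left _ hβ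
    rw [hq]
    refine ⟨⟨by positivity, ?_⟩, ?_⟩
    · rw [mem_cycloid_iff]
      refine ⟨k, 1, ?_, ?_⟩ <;> push_cast <;> ring
    · rintro ξ ⟨hξ, hmem⟩
      rw [mem_cycloid_iff] at hmem
      obtain ⟨m, n, h1, h2⟩ := hmem
      have h := key ξ m n h1 h2
      have hξ' : (0 : ℤ) < ξ := by exact_mod_cast hξ
      have hn : 0 < n := by
        have : 0 < n * ((α : ℤ) * ((β * k : ℕ) : ℤ) + β * γ) := by
          rw [← h]; positivity
        exact pos_of_mul_pos_left this hA.le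
      have h3 : ((α : ℤ) * k + γ) * β ≤ ξ * β := by
        rw [h]
        push_cast at hA ⊢
        nlinarith
      have h4 := le_of_mul_le_mul_right h3 hβ'
      exact_mod_cast h4
  · rintro ⟨⟨hξ, hmem⟩, -⟩
    rw [mem_cycloid_iff] at hmem
    obtain ⟨m, n, h1, h2⟩ := hmem
    have h := key _ m n h1 h2
    have hle := Nat.div_mul_le_self (α * δ + β * γ) β
    generalize (α * δ + β * γ) / β = ξ at *
    have hξ' : (0 : ℤ) < ξ := by exact_mod_cast hξ
    have hle' : (ξ : ℤ) * β ≤ α * δ + β * γ := by exact_mod_cast hle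
    have hpos : (0 : ℤ) < ξ * β := by positivity
    have hn : 0 < n := by
      rw [h] at hpos
      exact pos_of_mul_pos_left hpos hA.le
    have hn1 : n ≤ 1 := by
      by_contra hc
      have : 2 ≤ n := by omega
      nlinarith
    have : n = 1 := by omega
    subst this
    have : (β : ℤ) ∣ δ := ⟨m, by linarith⟩
    exact_mod_cast this
end

section
/- For positive integers α, β, γ, δ with A = α·δ + β·γ, the following are equivalent: (i) α divides γ; (ii) the least positive integer η such that (0, η) ∈ Λ(α,β,γ,δ) equals A/α. (A cycloid system is co-regular — each backward cycle contains exactly one token — if and only if α ∣ γ, and in this case it contains α co-processes, each of length p′ = A/α.) -/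
theorem cycloid_mem_aux (α β γ δ : ℕ) (η : ℕ) :
    ((0 : ℤ), (η : ℤ)) ∈ cycloidLattice α β γ δ ↔
      ∃ m n : ℤ, m * α + n * γ = 0 ∧ -(m * β) + n * δ = η := by
  unfold cycloidLattice
  rw [AddSubgroup.mem_closure_pair]
  simp [Prod.ext_iff]

theorem cycloid_pos_aux (α β γ δ : ℕ) (hα : 0 < α) (η : ℕ) (hη : 0 < η) (m n : ℤ)
    (h1 : m * α + n * γ = 0) (h2 : -(m * β) + n * δ = η) :
    (α : ℤ) * η = n * (α * δ + β * γ) ∧ 1 ≤ n := by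
  have h : (α : ℤ) * η = n * (α * δ + β * γ) := by
    linear_combination (-(α : ℤ)) * h2 - (β : ℤ) * h1
  refine ⟨h, ?_⟩
  have hp : (0 : ℤ) < α * η := by positivity
  have hA : (0 : ℤ) ≤ α * δ + β * γ := by positivity
  by_contra hn
  have : n ≤ 0 := by omega
  nlinarith

theorem coregular_iff_backward_cycle_length (α β γ δ : ℕ)
    (hα : 0 < α) (hβ : 0 < β) (hγ : 0 < γ) (hδ : 0 < δ) :
    α ∣ γ ↔
      IsLeast {η : ℕ | 0 < η ∧ ((0 : ℤ), (η : ℤ)) ∈ cycloidLattice α β γ δ}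
        ((α * δ + β * γ) / α) := by
  have hA : (0 : ℤ) < α * δ + β * γ := by positivity
  constructor
  · rintro ⟨k, rfl⟩
    have e : (α * δ + β * (α * k)) / α = δ + β * k := by
      rw [show α * δ + β * (α * k) = α * (δ + β * k) by ring]
      exact Nat.mul_div_cancel_left _ hα
    rw [e]
    refine ⟨⟨by positivity, ?_⟩, ?_⟩
    · rw [cycloid_mem_aux]
      refine ⟨-k, 1, ?_, ?_⟩ <;> push_cast <;> ring
    · rintro η ⟨hη, hm⟩
      rw [cycloid_mem_aux] at hm
      obtain ⟨m, n, h1, h2⟩ := hm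
      obtain ⟨h, hn⟩ := cycloid_pos_aux _ _ _ _ hα η hη m n h1 h2
      have h3 : (α : ℤ) * (δ + β * k) ≤ α * η := by
        rw [h]; push_cast at hA ⊢; nlinarith
      have h4 : α * (δ + β * k) ≤ α * η := by exact_mod_cast h3
      exact Nat.le_of_mul_le_mul_left h4 hα
  · rintro ⟨⟨hη, hm⟩, -⟩
    have hle := Nat.mul_div_le (α * δ + β * γ) α
    generalize (α * δ + β * γ) / α = η at *
    rw [cycloid_mem_aux] at hm
    obtain ⟨m, n, h1, h2⟩ := hm
    obtain ⟨h, hn⟩ := cycloid_pos_aux _ _ _ _ hα η hη m n h1 h2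
    have hle' : (α : ℤ) * η ≤ α * δ + β * γ := by exact_mod_cast hle
    have hn1 : n = 1 := by
      by_contra hne
      have : 2 ≤ n := by omega
      nlinarith
    subst hn1
    have : (α : ℤ) ∣ γ := ⟨-m, by linear_combination h1⟩
    exact_mod_cast this
end

section
/- Let α and p be positive integers, let β ≥ 2 be an integer, and let γ″, δ″ be positive integers such that (β − 1) ∣ δ″ and (α + 1)·δ″ + (β − 1)·γ″ = (β − 1)·p. Then the additive subgroup of ℤ × ℤ generated by (α + 1, −(β − 1)) and (γ″, δ″) equals the additive subgroup generated by (α + 1, −(β − 1)) and (p − (α + 1), β − 1). (Hence every regular cycloid C(α+1, β−1, γ″, δ″) with process length p is isomorphic to the cycloid C(α+1, β−1, p−(α+1), β−1), which has the same process length p as any regular cycloid C(α,β,γ,δ) with process length p.) -/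
theorem regular_cycloid_same_process_length_iso (α β p γ'' δ'' : ℕ)
    (hα : 0 < α) (hp : 0 < p) (hβ : 2 ≤ β)
    (hγ'' : 0 < γ'') (hδ'' : 0 < δ'')
    (hreg : (β - 1) ∣ δ'')
    (hlen : (α + 1) * δ'' + (β - 1) * γ'' = (β - 1) * p) :
    (AddSubgroup.closure {(((α : ℤ) + 1), -((β : ℤ) - 1)), ((γ'' : ℤ), (δ'' : ℤ))} :
        AddSubgroup (ℤ × ℤ)) =
      AddSubgroup.closure {(((α : ℤ) + 1), -((β : ℤ) - 1)),
        ((p : ℤ) - ((α : ℤ) + 1), (β : ℤ) - 1)} := by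
  obtain ⟨k, rfl⟩ := hreg
  obtain ⟨b, rfl⟩ : ∃ b, β = b + 1 := ⟨β - 1, by omega⟩
  simp only [Nat.add_sub_cancel] at *
  have hb : 0 < b := by omega
  have h : (α + 1) * k + γ'' = p := by
    apply Nat.eq_of_mul_eq_mul_left hb
    rw [← hlen]; ring
  subst h
  apply le_antisymm
  · rw [AddSubgroup.closure_le]
    rintro z (rfl | rfl)
    · exact AddSubgroup.subset_closure (by simp)
    · rw [SetLike.mem_coe, AddSubgroup.mem_closure_pair]
      refine ⟨1 - (k : ℤ), 1, ?_⟩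
      ext <;> simp <;> ring
  · rw [AddSubgroup.closure_le]
    rintro z (rfl | rfl)
    · exact AddSubgroup.subset_closure (by simp)
    · rw [SetLike.mem_coe, AddSubgroup.mem_closure_pair]
      refine ⟨(k : ℤ) - 1, 1, ?_⟩
      ext <;> simp <;> ring
end

section
/- For positive integers α, β, γ, δ, the image in the quotient group (ℤ × ℤ)/Λ(α,β,γ,δ) of the set {(ξ, η) ∈ ℤ × ℤ : β·ξ + α·η ≤ 0 and β·(ξ + 1) + α·η > 0} has exactly β elements. (The standard initial marking of a cycloid system contains exactly β tokens in forward places.) -/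
theorem standard_marking_forward_tokens (α β γ δ : ℕ)
    (hα : 0 < α) (hβ : 0 < β) (hγ : 0 < γ) (hδ : 0 < δ) :
    (((QuotientAddGroup.mk '' {p : ℤ × ℤ |
        (β : ℤ) * p.1 + α * p.2 ≤ 0 ∧ (β : ℤ) * (p.1 + 1) + α * p.2 > 0}) :
      Set ((ℤ × ℤ) ⧸ cycloidLattice α β γ δ))).ncard = β := by
  have hβ' : (0 : ℤ) < β := by exact_mod_cast hβ
  have hα' : (0 : ℤ) < α := by exact_mod_cast hα
  have hγ' : (0 : ℤ) < γ := by exact_mod_cast hγ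
  have hδ' : (0 : ℤ) < δ := by exact_mod_cast hδ
  have key : ∀ n : ℤ, (β : ℤ) * ((-(α * n)) / β) + α * n ≤ 0 ∧
      (β : ℤ) * ((-(α * n)) / β + 1) + α * n > 0 := by
    intro n
    have h1 := Int.mul_ediv_add_emod (-(α * n)) (β : ℤ)
    have h2 := Int.emod_nonneg (-(α * n)) hβ'.ne'
    have h3 := Int.emod_lt_of_pos (-(α * n)) hβ'
    constructor <;> linarith
  -- the first coordinate of a point in the strip is determined by the second
  have uniq : ∀ x y n : ℤ, (β : ℤ) * x + α * n ≤ 0 → (β : ℤ) * (x + 1) + α * n > 0 →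
      (β : ℤ) * y + α * n ≤ 0 → (β : ℤ) * (y + 1) + α * n > 0 → x = y := by
    intro x y n h1 h2 h3 h4
    have h5 : x < y + 1 := lt_of_mul_lt_mul_left (by linarith) hβ'.le
    have h6 : y < x + 1 := lt_of_mul_lt_mul_left (by linarith) hβ'.le
    omega
  let g : ℕ → (ℤ × ℤ) ⧸ cycloidLattice α β γ δ :=
    fun n => QuotientAddGroup.mk ((-((α : ℤ) * n)) / (β : ℤ), (n : ℤ))
  have himg : (((QuotientAddGroup.mk '' {p : ℤ × ℤ |
        (β : ℤ) * p.1 + α * p.2 ≤ 0 ∧ (β : ℤ) * (p.1 + 1) + α * p.2 > 0}) :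
      Set ((ℤ × ℤ) ⧸ cycloidLattice α β γ δ))) = g '' (Finset.range β : Set ℕ) := by
    ext q
    constructor
    · rintro ⟨⟨x, n⟩, ⟨h1, h2⟩, rfl⟩
      simp only at h1 h2
      have hr0 := Int.emod_nonneg n hβ'.ne'
      have hr1 := Int.emod_lt_of_pos n hβ'
      have hd := Int.mul_ediv_add_emod n (β : ℤ)
      obtain ⟨m, hm⟩ := Int.eq_ofNat_of_zero_le hr0
      refine ⟨m, ?_, ?_⟩
      · simp only [Finset.coe_range, Set.mem_Iio]
        omega
      · have hx : (-((α : ℤ) * m)) / (β : ℤ) = x + α * (n / β) := by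
          obtain ⟨k1, k2⟩ := key m
          have hn : n = β * (n / β) + m := by rw [← hm]; exact hd.symm
          generalize n / (β : ℤ) = k at hn
          subst hn
          exact uniq _ _ m k1 k2 (by linarith) (by linarith)
        simp only [g]
        rw [QuotientAddGroup.eq, hx]
        unfold cycloidLattice
        rw [AddSubgroup.mem_closure_pair]
        refine ⟨-(n / β), 0, ?_⟩
        have hd' : n = β * (n / β) + m := by rw [← hm]; exact hd.symm
        ext
        · simp; ring
        · simp; linarith
    · rintro ⟨m, -, rfl⟩
      exact ⟨_, key m, rfl⟩
  rw [himg, Set.ncard_image_of_injOn, Set.ncard_coe_finset, Finset.card_range]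
  intro m hm n hn h
  simp only [Finset.coe_range, Set.mem_Iio] at hm hn
  simp only [g] at h
  rw [QuotientAddGroup.eq] at h
  unfold cycloidLattice at h
  rw [AddSubgroup.mem_closure_pair] at h
  obtain ⟨a, b, hab⟩ := h
  obtain ⟨k1, k2⟩ := key m
  obtain ⟨k3, k4⟩ := key n
  have e1 := congrArg Prod.fst hab
  have e2 := congrArg Prod.snd hab
  simp only [Prod.fst_add, Prod.snd_add, Prod.smul_fst, Prod.smul_snd, smul_eq_mul,
    Prod.fst_neg, Prod.snd_neg] at e1 e2
  generalize (-((α : ℤ) * m)) / (β : ℤ) = x at *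
  generalize (-((α : ℤ) * n)) / (β : ℤ) = y at *
  have e3 : b * ((β : ℤ) * γ + α * δ) = (β * y + α * n) - (β * x + α * m) := by
    linear_combination (β : ℤ) * e1 + (α : ℤ) * e2
  have hbig : (β : ℤ) ≤ β * γ + α * δ := by nlinarith [mul_pos hα' hδ']
  have hb : b = 0 := by
    rcases lt_trichotomy b 0 with h | h | h
    · nlinarith
    · exact h
    · nlinarith
  subst hb
  have e4 : (n : ℤ) - m = β * (-a) := by linarith
  have ha : -a = 0 := by
    have h1 : -a < 1 := lt_of_mul_lt_mul_left (a := (β : ℤ)) (by omega) hβ'.le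
    have h2 : -1 < -a := lt_of_mul_lt_mul_left (a := (β : ℤ)) (by omega) hβ'.le
    omega
  rw [ha] at e4
  omega
end

section
/- For positive integers α, β, γ, δ, the image in the quotient group (ℤ × ℤ)/Λ(α,β,γ,δ) of the set {(ξ, η) ∈ ℤ × ℤ : β·ξ + α·η ≤ 0 and β·ξ + α·(η + 1) > 0} has exactly α elements. (The standard initial marking of a cycloid system contains exactly α tokens in backward places.) -/
theorem standard_marking_backward_tokens (α β γ δ : ℕ)
    (hα : 0 < α) (hβ : 0 < β) (hγ : 0 < γ) (hδ : 0 < δ) :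
    (((QuotientAddGroup.mk '' {p : ℤ × ℤ |
        (β : ℤ) * p.1 + α * p.2 ≤ 0 ∧ (β : ℤ) * p.1 + α * (p.2 + 1) > 0}) :
      Set ((ℤ × ℤ) ⧸ cycloidLattice α β γ δ))).ncard = α := by
  have ha : (0 : ℤ) < α := by exact_mod_cast hα
  have hb : (0 : ℤ) < β := by exact_mod_cast hβ
  have hc : (0 : ℤ) < γ := by exact_mod_cast hγ
  have hd : (0 : ℤ) < δ := by exact_mod_cast hδ
  have hf : ∀ x : ℤ, (β : ℤ) * x + α * ((-(β * x)) / α) ≤ 0 ∧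
      (β : ℤ) * x + α * ((-(β * x)) / α + 1) > 0 := by
    intro x
    have h1 := Int.mul_ediv_add_emod (-((β : ℤ) * x)) α
    have h2 := Int.emod_nonneg (-((β : ℤ) * x)) ha.ne'
    have h3 := Int.emod_lt_of_pos (-((β : ℤ) * x)) ha
    constructor <;> linarith
  have key : (QuotientAddGroup.mk '' {p : ℤ × ℤ |
        (β : ℤ) * p.1 + α * p.2 ≤ 0 ∧ (β : ℤ) * p.1 + α * (p.2 + 1) > 0} :
      Set ((ℤ × ℤ) ⧸ cycloidLattice α β γ δ)) =
      (fun x : ℤ => (QuotientAddGroup.mk (x, (-((β : ℤ) * x)) / α) :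
        (ℤ × ℤ) ⧸ cycloidLattice α β γ δ)) '' (Finset.Ico (0 : ℤ) α : Finset ℤ) := by
    ext q
    constructor
    · rintro ⟨⟨x, y⟩, ⟨h1, h2⟩, rfl⟩
      simp only at h1 h2
      refine ⟨x % α, ?_, ?_⟩
      · simp [Int.emod_nonneg x ha.ne', Int.emod_lt_of_pos x ha]
      · refine QuotientAddGroup.eq.mpr ?_
        refine AddSubgroup.mem_closure_pair.mpr ⟨x / α, 0, ?_⟩
        have hx := Int.mul_ediv_add_emod x α
        obtain ⟨h3, h4⟩ := hf (x % α)
        generalize (-((β : ℤ) * (x % α))) / α = z at *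
        generalize x % α = r at *
        generalize x / α = k at *
        subst hx
        have e1 : y + β * k - z < 1 := by
          by_contra hh
          push Not at hh
          nlinarith
        have e2 : -1 < y + β * k - z := by
          by_contra hh
          push Not at hh
          nlinarith
        ext
        · simp; ring
        · simp; linarith [show y + β * k - z = 0 by omega]
    · rintro ⟨x, -, rfl⟩
      exact ⟨_, hf x, rfl⟩
  rw [key, Set.ncard_image_of_injOn, Set.ncard_coe_finset]
  · simp
  · intro x hx x' hx' h
    simp only [Finset.coe_Ico, Set.mem_Ico] at hx hx'
    obtain ⟨m, n, hmn⟩ := AddSubgroup.mem_closure_pair.mp (QuotientAddGroup.eq.mp h)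
    obtain ⟨h1, h2⟩ := hf x
    obtain ⟨h3, h4⟩ := hf x'
    generalize (-((β : ℤ) * x)) / α = y at *
    generalize (-((β : ℤ) * x')) / α = y' at *
    simp [Prod.ext_iff] at hmn
    obtain ⟨e1, e2⟩ := hmn
    have e3 : (β * x' + α * y') - (β * x + α * y) = n * (β * γ + α * δ) := by
      linear_combination -(β : ℤ) * e1 - α * e2
    have hD : (α : ℤ) ≤ β * γ + α * δ := by nlinarith [mul_pos hb hc]
    have n1 : n < 1 := by
      by_contra hh
      push Not at hh
      nlinarith
    have n2 : -1 < n := by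
      by_contra hh
      push Not at hh
      nlinarith
    obtain rfl : n = 0 := by omega
    have m1 : m < 1 := by
      by_contra hh
      push Not at hh
      nlinarith
    have m2 : -1 < m := by
      by_contra hh
      push Not at hh
      nlinarith
    obtain rfl : m = 0 := by omega
    linarith
end

section
/- For positive integers α, β, γ, δ with A = α·δ + β·γ, the least positive integer ξ such that A ∣ δ·ξ and A ∣ β·ξ equals A / gcd(β, δ). -/
theorem least_xi_dvd (α β γ δ : ℕ)
    (hα : 0 < α) (hβ : 0 < β) (hγ : 0 < γ) (hδ : 0 < δ)
    (A : ℕ) (hA : A = α * δ + β * γ) :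
    IsLeast {ξ : ℕ | 0 < ξ ∧ A ∣ δ * ξ ∧ A ∣ β * ξ} (A / Nat.gcd β δ) := by
  have hg : 0 < Nat.gcd β δ := Nat.gcd_pos_of_pos_left _ hβ
  have hApos : 0 < A := by rw [hA]; positivity
  have hd : Nat.gcd β δ ∣ A := by
    rw [hA]
    exact dvd_add (Dvd.dvd.mul_left (Nat.gcd_dvd_right β δ) α)
      (Dvd.dvd.mul_right (Nat.gcd_dvd_left β δ) γ)
  have hk : Nat.gcd β δ * (A / Nat.gcd β δ) = A := Nat.mul_div_cancel' hd
  refine ⟨⟨Nat.div_pos (Nat.le_of_dvd hApos hd) hg, ?_, ?_⟩, ?_⟩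
  · have h := Nat.mul_dvd_mul_right (Nat.gcd_dvd_right β δ) (A / Nat.gcd β δ)
    rwa [hk] at h
  · have h := Nat.mul_dvd_mul_right (Nat.gcd_dvd_left β δ) (A / Nat.gcd β δ)
    rwa [hk] at h
  · rintro ξ ⟨hξ, h1, h2⟩
    have h := Nat.dvd_gcd h2 h1
    rw [Nat.gcd_mul_right] at h
    have h3 : Nat.gcd β δ * (A / Nat.gcd β δ) ∣ Nat.gcd β δ * ξ := by rwa [hk]
    exact Nat.le_of_dvd hξ (Nat.dvd_of_mul_dvd_mul_left hg h3)
end
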